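/- Let 0 < β < 1, γ > -β, 1 < m ≤ (γ+1)/(1-β), and b ≥ 0. Then the problem y'(t) + D_0^β y(t) ≥ t^γ |y(t)|^m for t > 0, with y(0) = b, admits no nontrivial global solution on [0,∞). -/

import Mathlib

open Real MeasureTheory Set Filter Topology

/-- Riemann–Liouville left-sided fractional integral of order `σ` based at `0`. -/
noncomputable def RLI (σ : ℝ) (f : ℝ → ℝ) (t : ℝ) : ℝ :=
  (1 / Real.Gamma σ) * ∫ s in (0 : ℝ)..t, (t - s) ^ (σ - 1) * f s

/-- Riemann–Liouville fractional derivative of order `β` based at `0`. -/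
noncomputable def RLD (β : ℝ) (f : ℝ → ℝ) (t : ℝ) : ℝ :=
  deriv (RLI (1 - β) f) t

theorem intervalIntegrable_abel_kernel {σ : ℝ} (hσ : 0 < σ) (t : ℝ) :
    IntervalIntegrable (fun s : ℝ => (t - s) ^ (σ - 1)) volume 0 t := by
  have h := (intervalIntegral.intervalIntegrable_rpow' (a := t) (b := 0)
    (by linarith : -1 < σ - 1)).comp_sub_left t
  simpa using h

theorem integral_abel_kernel {σ : ℝ} (hσ : 0 < σ) (t : ℝ) :
    ∫ s in (0 : ℝ)..t, (t - s) ^ (σ - 1) = t ^ σ / σ := by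
  rw [intervalIntegral.integral_comp_sub_left (fun x : ℝ => x ^ (σ - 1)) t,
    integral_rpow (Or.inl (by linarith))]
  simp [Real.zero_rpow hσ.ne']

theorem abs_RLI_le {σ : ℝ} (hσ : 0 < σ) {y : ℝ → ℝ} {t M : ℝ} (ht : 0 ≤ t)
    (hM : ∀ s ∈ Icc 0 t, |y s| ≤ M) :
    |RLI σ y t| ≤ 1 / Real.Gamma σ * (t ^ σ / σ * M) := by
  have hΓ : 0 < Real.Gamma σ := Real.Gamma_pos_of_pos hσ
  rw [RLI, abs_mul, abs_of_pos (by positivity : 0 < 1 / Real.Gamma σ)]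
  gcongr
  rw [← integral_abel_kernel hσ t, ← intervalIntegral.integral_mul_const, ← Real.norm_eq_abs]
  refine intervalIntegral.norm_integral_le_of_norm_le ht (ae_of_all _ fun s hs => ?_)
    ((intervalIntegrable_abel_kernel hσ t).mul_const M)
  have h0 : 0 ≤ (t - s) ^ (σ - 1) := Real.rpow_nonneg (by linarith [hs.2]) _
  rw [norm_mul, Real.norm_of_nonneg h0, Real.norm_eq_abs]
  exact mul_le_mul_of_nonneg_left (hM s (Ioc_subset_Icc_self hs)) h0

theorem continuousWithinAt_RLI_zero {σ : ℝ} (hσ : 0 < σ) {y : ℝ → ℝ}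
    (hy : ContinuousOn y (Ici 0)) : ContinuousWithinAt (RLI σ y) (Ici 0) 0 := by
  obtain ⟨M, hM⟩ := isCompact_Icc.exists_bound_of_continuousOn
    (hy.mono (Icc_subset_Ici_self : Icc (0 : ℝ) 1 ⊆ Ici 0))
  have h0 : RLI σ y 0 = 0 := by simp [RLI]
  rw [ContinuousWithinAt, h0]
  have hlim : Tendsto (fun t : ℝ => 1 / Real.Gamma σ * (t ^ σ / σ * M)) (𝓝[Ici 0] 0) (𝓝 0) := by
    have hc : Continuous fun t : ℝ => 1 / Real.Gamma σ * (t ^ σ / σ * M) :=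
      continuous_const.mul (((Real.continuous_rpow_const hσ.le).div_const _).mul continuous_const)
    have := (hc.tendsto 0).mono_left (nhdsWithin_le_nhds (s := Ici 0))
    simpa [Real.zero_rpow hσ.ne'] using this
  refine squeeze_zero_norm' ?_ hlim
  filter_upwards [self_mem_nhdsWithin, nhdsWithin_le_nhds (Iio_mem_nhds zero_lt_one)] with t ht ht1
  exact abs_RLI_le hσ ht fun s hs => hM s ⟨hs.1, hs.2.trans (le_of_lt ht1)⟩

theorem integral_mul_RLI_le {σ T : ℝ} (hσ : 0 < σ) (hT : 0 ≤ T) {y w : ℝ → ℝ}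
    (hy : ContinuousOn y (Icc 0 T)) (hw : ContinuousOn w (Icc 0 T))
    (hw0 : ∀ t ∈ Icc 0 T, 0 ≤ w t) (hanti : AntitoneOn w (Icc 0 T))
    (hI : ContinuousOn (RLI σ y) (Icc 0 T)) :
    ∫ t in (0 : ℝ)..T, w t * RLI σ y t ≤
      T ^ σ / (σ * Real.Gamma σ) * ∫ t in (0 : ℝ)..T, |y t| * w t := by
  have hΓ : 0 < Real.Gamma σ := Real.Gamma_pos_of_pos hσ
  set f : ℝ → ℝ := (Ioc 0 T).indicator fun s => |y s| * w s with hf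
  set k : ℝ → ℝ := (Icc 0 T).indicator fun r => r ^ (σ - 1) with hk
  have hsub : Ioc 0 T ⊆ Icc 0 T := Ioc_subset_Icc_self
  have hyw : IntervalIntegrable (fun s => |y s| * w s) volume 0 T :=
    ContinuousOn.intervalIntegrable_of_Icc hT (hy.abs.mul hw)
  have hpow : IntervalIntegrable (fun r : ℝ => r ^ (σ - 1)) volume 0 T :=
    intervalIntegral.intervalIntegrable_rpow' (by linarith)
  have hfi : Integrable f := by
    rw [hf, integrable_indicator_iff measurableSet_Ioc]
    exact (intervalIntegrable_iff_integrableOn_Ioc_of_le hT).1 hyw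
  have hki : Integrable k := by
    rw [hk, integrable_indicator_iff measurableSet_Icc]
    exact (intervalIntegrable_iff_integrableOn_Icc_of_le hT).1 hpow
  have hf0 : ∀ s, 0 ≤ f s := fun s =>
    indicator_nonneg (fun s hs => mul_nonneg (abs_nonneg _) (hw0 s (hsub hs))) s
  have hk0 : ∀ s, 0 ≤ k s := fun s =>
    indicator_nonneg (fun s hs => Real.rpow_nonneg hs.1 _) s
  have hfint : ∫ x in Ioi 0, f x = ∫ t in (0 : ℝ)..T, |y t| * w t := by
    rw [hf, setIntegral_indicator measurableSet_Ioc, intervalIntegral.integral_of_le hT,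
      inter_eq_self_of_subset_right Ioc_subset_Ioi_self]
  have hkint : ∫ x in Ioi 0, k x = T ^ σ / σ := by
    rw [hk, setIntegral_indicator measurableSet_Icc,
      show Ioi (0 : ℝ) ∩ Icc 0 T = Ioc 0 T by ext; simp +contextual [le_of_lt],
      ← intervalIntegral.integral_of_le hT, integral_rpow (Or.inl (by linarith))]
    simp [Real.zero_rpow hσ.ne']
  have hconv := integral_posConvolution (μ := volume) (ν := volume) hfi.integrableOn
    hki.integrableOn (ContinuousLinearMap.mul ℝ ℝ)
  have hconvi := integrable_posConvolution (μ := volume) (ν := volume)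
    hfi.integrableOn hki.integrableOn (ContinuousLinearMap.mul ℝ ℝ)
  rw [posConvolution, integrable_indicator_iff measurableSet_Ioi] at hconvi
  simp only [ContinuousLinearMap.mul_apply'] at hconv hconvi
  rw [hfint, hkint] at hconv
  have hle : ∫ t in (0 : ℝ)..T, w t * RLI σ y t ≤
      ∫ t in (0 : ℝ)..T, 1 / Real.Gamma σ * ∫ s in (0 : ℝ)..t, f s * k (t - s) := by
    refine intervalIntegral.integral_mono_on_of_le_Ioo hT
      (ContinuousOn.intervalIntegrable_of_Icc hT (hw.mul hI))
      (((intervalIntegrable_iff_integrableOn_Ioc_of_le hT).2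
        (hconvi.mono_set Ioc_subset_Ioi_self)).const_mul _) fun t ht => ?_
    rw [RLI, mul_left_comm]
    gcongr
    have hker := intervalIntegrable_abel_kernel hσ t
    have htT : Icc 0 t ⊆ Icc 0 T := Icc_subset_Icc_right ht.2.le
    have huI : uIcc 0 t = Icc 0 t := uIcc_of_le ht.1.le
    have heq : ∫ s in (0 : ℝ)..t, f s * k (t - s) =
        ∫ s in (0 : ℝ)..t, (t - s) ^ (σ - 1) * (|y s| * w s) := by
      refine intervalIntegral.integral_congr_ae (ae_of_all _ fun s hs => ?_)
      rw [uIoc_of_le ht.1.le] at hs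
      rw [hf, hk, indicator_of_mem (show s ∈ Ioc 0 T from ⟨hs.1, hs.2.trans ht.2.le⟩),
        indicator_of_mem (show t - s ∈ Icc 0 T from
          ⟨by linarith [hs.2], by linarith [hs.1, ht.2]⟩), mul_comm]
    rw [heq, ← intervalIntegral.integral_const_mul]
    refine intervalIntegral.integral_mono_on ht.1.le
      ((hker.mul_continuousOn (huI ▸ hy.mono htT)).const_mul _)
      (hker.mul_continuousOn (huI ▸ (hy.abs.mul hw).mono htT)) fun s hs => ?_
    rw [mul_left_comm]
    refine mul_le_mul_of_nonneg_left ?_ (Real.rpow_nonneg (by linarith [hs.2]) _)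
    have h1 : w t ≤ w s := hanti (htT hs) ⟨ht.1.le, ht.2.le⟩ hs.2
    have h2 : 0 ≤ w t := hw0 t ⟨ht.1.le, ht.2.le⟩
    calc w t * y s ≤ w t * |y s| := mul_le_mul_of_nonneg_left (le_abs_self _) h2
      _ ≤ w s * |y s| := mul_le_mul_of_nonneg_right h1 (abs_nonneg _)
      _ = |y s| * w s := mul_comm _ _
  refine hle.trans ?_
  rw [intervalIntegral.integral_const_mul, intervalIntegral.integral_of_le hT]
  have hmono : ∫ t in Ioc 0 T, ∫ s in (0 : ℝ)..t, f s * k (t - s) ≤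
      ∫ t in Ioi 0, ∫ s in (0 : ℝ)..t, f s * k (t - s) := by
    refine setIntegral_mono_set hconvi ?_ (Ioc_subset_Ioi_self.eventuallyLE)
    refine (ae_restrict_iff' measurableSet_Ioi).2 (ae_of_all _ fun t ht => ?_)
    exact intervalIntegral.integral_nonneg (le_of_lt ht) fun s _ => mul_nonneg (hf0 s) (hk0 _)
  calc 1 / Real.Gamma σ * ∫ t in Ioc 0 T, ∫ s in (0 : ℝ)..t, f s * k (t - s)
      ≤ 1 / Real.Gamma σ * ((∫ t in (0 : ℝ)..T, |y t| * w t) * (T ^ σ / σ)) := by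
        rw [← hconv]; gcongr
    _ = _ := by field_simp

theorem integral_mul_rpow_le_of_hasDerivAt {G G' g : ℝ → ℝ} {T p : ℝ} (hT : 0 ≤ T) (hp : 0 ≤ p)
    (hG : ContinuousOn G (Icc 0 T)) (hG0 : 0 ≤ G 0)
    (hd : ∀ t ∈ Ioo 0 T, HasDerivAt G (G' t) t) (hg : IntervalIntegrable g volume 0 T)
    (hle : ∀ t ∈ Ioo 0 T, g t ≤ G' t) :
    ∫ t in (0 : ℝ)..T, g t * (T - t) ^ (p + 1) ≤
      (p + 1) * ∫ t in (0 : ℝ)..T, (T - t) ^ p * G t := by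
  have hcont : ∀ q : ℝ, 0 ≤ q → Continuous fun t : ℝ => (T - t) ^ q := fun q hq =>
    (Real.continuous_rpow_const hq).comp (continuous_const.sub continuous_id)
  have hi1 : IntervalIntegrable (fun t => g t * (T - t) ^ (p + 1)) volume 0 T :=
    hg.mul_continuousOn (hcont _ (by linarith)).continuousOn
  have hi2 : IntervalIntegrable (fun t => (p + 1) * ((T - t) ^ p * G t)) volume 0 T :=
    (ContinuousOn.intervalIntegrable_of_Icc hT ((hcont _ hp).continuousOn.mul hG)).const_mul _
  have key := intervalIntegral.integral_le_sub_of_hasDeriv_right_of_le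
    (g := fun t => G t * (T - t) ^ (p + 1))
    (g' := fun t => G' t * (T - t) ^ (p + 1) + G t * (-1 * (p + 1) * (T - t) ^ (p + 1 - 1)))
    (φ := fun t => g t * (T - t) ^ (p + 1) - (p + 1) * ((T - t) ^ p * G t)) hT
    (hG.mul (hcont _ (by linarith)).continuousOn)
    (fun t ht => ((hd t ht).mul (((hasDerivAt_id t).const_sub T).rpow_const
      (Or.inl (by simpa using (sub_pos.2 ht.2).ne')))).hasDerivWithinAt)
    ((intervalIntegrable_iff_integrableOn_Icc_of_le hT).1 (hi1.sub hi2)) (fun t ht => by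
      have h1 : 0 ≤ (T - t) ^ (p + 1) := Real.rpow_nonneg (by linarith [ht.2]) _
      have h2 := mul_le_mul_of_nonneg_right (hle t ht) h1
      rw [add_sub_cancel_right]
      linarith)
  rw [intervalIntegral.integral_sub hi1 hi2, intervalIntegral.integral_const_mul] at key
  have h0 : 0 ≤ G 0 * (T - 0) ^ (p + 1) := mul_nonneg hG0 (Real.rpow_nonneg (by linarith) _)
  simp only [sub_self, Real.zero_rpow (by linarith : p + 1 ≠ 0), mul_zero] at key
  linarith

theorem integral_mul_rpow_le_of_le_deriv_add_RLD {β p T : ℝ} (hβ1 : β < 1) (hp : 0 ≤ p)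
    (hT : 1 ≤ T) {y g : ℝ → ℝ} (hycont : ContinuousOn y (Ici 0)) (hy0 : 0 ≤ y 0)
    (hydiff : ∀ t > (0 : ℝ), DifferentiableAt ℝ y t)
    (hDdiff : ∀ t > (0 : ℝ), DifferentiableAt ℝ (RLI (1 - β) y) t)
    (hg : IntervalIntegrable g volume 0 T)
    (hineq : ∀ t > (0 : ℝ), g t ≤ deriv y t + RLD β y t) :
    ∫ t in (0 : ℝ)..T, g t * (T - t) ^ (p + 1) ≤
      (p + 1) * (1 + 1 / ((1 - β) * Real.Gamma (1 - β))) * T ^ (1 - β) *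
        ∫ t in (0 : ℝ)..T, |y t| * (T - t) ^ p := by
  have hσ : 0 < 1 - β := by linarith
  have hT0 : 0 ≤ T := by linarith
  have hΓ : 0 < Real.Gamma (1 - β) := Real.Gamma_pos_of_pos hσ
  have hy : ContinuousOn y (Icc 0 T) := hycont.mono Icc_subset_Ici_self
  have hI : ContinuousOn (RLI (1 - β) y) (Icc 0 T) := by
    intro t ht
    rcases ht.1.eq_or_lt with rfl | h
    · exact (continuousWithinAt_RLI_zero hσ hycont).mono Icc_subset_Ici_self
    · exact (hDdiff t h).continuousAt.continuousWithinAt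
  have hw : Continuous fun t : ℝ => (T - t) ^ p :=
    (Real.continuous_rpow_const hp).comp (continuous_const.sub continuous_id)
  have hw0 : ∀ t ∈ Icc 0 T, 0 ≤ (T - t) ^ p := fun t ht =>
    Real.rpow_nonneg (by linarith [ht.2]) _
  have h1 := integral_mul_rpow_le_of_hasDerivAt (G := fun t => y t + RLI (1 - β) y t) hT0 hp
    (hy.add hI) (by simpa [RLI] using hy0)
    (fun t ht => (hydiff t ht.1).hasDerivAt.add (hDdiff t ht.1).hasDerivAt) hg
    (fun t ht => hineq t ht.1)
  have h2 := integral_mul_RLI_le hσ hT0 hy hw.continuousOn hw0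
    (fun s _ t ht hst => Real.rpow_le_rpow (by linarith [ht.2]) (by linarith) hp) hI
  have h3 : ∫ t in (0 : ℝ)..T, (T - t) ^ p * y t ≤ ∫ t in (0 : ℝ)..T, |y t| * (T - t) ^ p := by
    refine intervalIntegral.integral_mono_on hT0
      (ContinuousOn.intervalIntegrable_of_Icc hT0 (hw.continuousOn.mul hy))
      (ContinuousOn.intervalIntegrable_of_Icc hT0 (hy.abs.mul hw.continuousOn)) fun t ht => ?_
    rw [mul_comm]
    exact mul_le_mul_of_nonneg_right (le_abs_self _) (hw0 t ht)
  have h4 : 0 ≤ ∫ t in (0 : ℝ)..T, |y t| * (T - t) ^ p :=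
    intervalIntegral.integral_nonneg hT0 fun t ht => mul_nonneg (abs_nonneg _) (hw0 t ht)
  have h5 : 1 ≤ T ^ (1 - β) := Real.one_le_rpow hT hσ.le
  have h7 : IntervalIntegrable (fun t => (T - t) ^ p * y t) volume 0 T :=
    ContinuousOn.intervalIntegrable_of_Icc hT0 (hw.continuousOn.mul hy)
  have h8 : IntervalIntegrable (fun t => (T - t) ^ p * RLI (1 - β) y t) volume 0 T :=
    ContinuousOn.intervalIntegrable_of_Icc hT0 (hw.continuousOn.mul hI)
  simp only [mul_add] at h1
  rw [intervalIntegral.integral_add h7 h8] at h1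
  set J := ∫ t in (0 : ℝ)..T, |y t| * (T - t) ^ p
  have h6 : J ≤ T ^ (1 - β) * J := le_mul_of_one_le_left h4 h5
  calc _ ≤ _ := h1
    _ ≤ (p + 1) * (T ^ (1 - β) * J + T ^ (1 - β) / ((1 - β) * Real.Gamma (1 - β)) * J) := by
        gcongr
        exact h3.trans h6
    _ = _ := by ring

theorem young_weighted {m p β γ K η T s x : ℝ} (hm : 1 < m) (hmp : m * p = p + 1)
    (hγ : m * (1 - β) ≤ γ + 1) (hK : 0 ≤ K) (hη : 0 < η) (hs1 : 1 ≤ s) (hsT : s ≤ T)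
    (hx : 0 ≤ x) :
    K * T ^ (1 - β) * (x * (T - s) ^ p) ≤
      η ^ m * (s ^ γ * x ^ m * (T - s) ^ (p + 1)) +
        (K / η) ^ (p + 1) * T ^ ((1 - β) * (p + 1)) * s ^ ((p + 1) * β - 1) := by
  have hm0 : m ≠ 0 := by linarith
  have hp : 0 < p := by nlinarith
  have hs : 0 < s := by linarith
  have hT : 0 < T := by linarith
  have hTs : 0 ≤ T - s := by linarith
  have hpq : m.HolderConjugate (p + 1) := by
    rw [Real.holderConjugate_iff]
    refine ⟨hm, ?_⟩
    field_simp
    linarith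
  set δ : ℝ := 1 - β - 1 / m with hδ
  have hδm : δ * m = m * (1 - β) - 1 := by rw [hδ]; field_simp
  have hy := Real.young_inequality_of_nonneg
    (a := η * s ^ δ * x * (T - s) ^ p) (b := K / η * T ^ (1 - β) * s ^ (-δ))
    (by positivity) (by positivity) hpq
  have e1 : η * s ^ δ * x * (T - s) ^ p * (K / η * T ^ (1 - β) * s ^ (-δ)) =
      K * T ^ (1 - β) * (x * (T - s) ^ p) := by
    rw [Real.rpow_neg hs.le]
    field_simp
  have e2 : (η * s ^ δ * x * (T - s) ^ p) ^ m =
      η ^ m * (s ^ (m * (1 - β) - 1) * x ^ m * (T - s) ^ (p + 1)) := by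
    rw [Real.mul_rpow (by positivity) (by positivity), Real.mul_rpow (by positivity) hx,
      Real.mul_rpow hη.le (by positivity), ← Real.rpow_mul hs.le, ← Real.rpow_mul hTs, hδm,
      mul_comm p m, hmp]
    ring
  have hexp : -δ * (p + 1) = (p + 1) * β - 1 := by
    rw [← hmp, hδ]; field_simp; linarith
  have e3 : (K / η * T ^ (1 - β) * s ^ (-δ)) ^ (p + 1) =
      (K / η) ^ (p + 1) * T ^ ((1 - β) * (p + 1)) * s ^ ((p + 1) * β - 1) := by
    rw [Real.mul_rpow (by positivity) (by positivity), Real.mul_rpow (by positivity)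
      (by positivity), ← Real.rpow_mul hs.le, ← Real.rpow_mul hT.le, hexp]
  rw [e1, e2, e3] at hy
  refine hy.trans (add_le_add ?_ ?_)
  · refine (div_le_self (by positivity) hm.le).trans ?_
    gcongr
    linarith
  · exact div_le_self (by positivity) (by linarith)

theorem integral_abs_mul_rpow_le {m p β γ K η R T : ℝ} (hm : 1 < m) (hmp : m * p = p + 1)
    (hβ : 0 < β)
    (hγ : m * (1 - β) ≤ γ + 1) (hK : 0 ≤ K) (hη : 0 < η) (hR1 : 1 ≤ R) (hRT : R ≤ T)
    {y : ℝ → ℝ} (hycont : ContinuousOn y (Ici 0)) :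
    K * T ^ (1 - β) * ∫ s in (0 : ℝ)..T, |y s| * (T - s) ^ p ≤
      K * T ^ (1 - β + p) * (∫ s in (0 : ℝ)..R, |y s|) +
        η ^ m * (∫ s in R..T, s ^ γ * |y s| ^ m * (T - s) ^ (p + 1)) +
          (K / η) ^ (p + 1) * T ^ (p + 1) / ((p + 1) * β) := by
  have hp : 0 < p := by nlinarith
  have hT : 0 < T := by linarith
  have hR : 0 < R := by linarith
  have hcont : ∀ q : ℝ, 0 ≤ q → Continuous fun t : ℝ => (T - t) ^ q := fun q hq =>
    (Real.continuous_rpow_const hq).comp (continuous_const.sub continuous_id)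
  have hy0 : ContinuousOn y (Icc 0 T) := hycont.mono Icc_subset_Ici_self
  have hyR : ContinuousOn y (Icc 0 R) := hycont.mono Icc_subset_Ici_self
  have hyRT : ContinuousOn y (Icc R T) := hy0.mono (Icc_subset_Icc_left hR.le)
  have i1 : IntervalIntegrable (fun s => |y s| * (T - s) ^ p) volume 0 R :=
    ContinuousOn.intervalIntegrable_of_Icc hR.le (hyR.abs.mul (hcont p hp.le).continuousOn)
  have i2 : IntervalIntegrable (fun s => |y s| * (T - s) ^ p) volume R T :=
    ContinuousOn.intervalIntegrable_of_Icc hRT (hyRT.abs.mul (hcont p hp.le).continuousOn)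
  have hpow : ∀ q : ℝ, ContinuousOn (fun s : ℝ => s ^ q) (Icc R T) := fun q =>
    continuousOn_id.rpow_const fun s hs => Or.inl (by simpa using (hR.trans_le hs.1).ne')
  have i3 : IntervalIntegrable (fun s => s ^ γ * |y s| ^ m * (T - s) ^ (p + 1)) volume R T :=
    ContinuousOn.intervalIntegrable_of_Icc hRT (((hpow γ).mul
      (hyRT.abs.rpow_const fun _ _ => Or.inr (by linarith))).mul
        (hcont (p + 1) (by linarith)).continuousOn)
  have i4 : IntervalIntegrable (fun s : ℝ => s ^ ((p + 1) * β - 1)) volume R T :=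
    ContinuousOn.intervalIntegrable_of_Icc hRT (hpow _)
  have hpos : 0 < (p + 1) * β := by positivity
  have i5 : IntervalIntegrable (fun s : ℝ => s ^ ((p + 1) * β - 1)) volume 0 T :=
    intervalIntegral.intervalIntegrable_rpow' (by linarith)
  have near : ∫ s in (0 : ℝ)..R, |y s| * (T - s) ^ p ≤ T ^ p * ∫ s in (0 : ℝ)..R, |y s| := by
    rw [← intervalIntegral.integral_const_mul]
    refine intervalIntegral.integral_mono_on hR.le i1
      ((ContinuousOn.intervalIntegrable_of_Icc hR.le hyR.abs).const_mul _) fun s hs => ?_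
    rw [mul_comm]
    refine mul_le_mul_of_nonneg_right ?_ (abs_nonneg _)
    exact Real.rpow_le_rpow (by linarith [hs.2]) (by linarith [hs.1]) hp.le
  have far : K * T ^ (1 - β) * ∫ s in R..T, |y s| * (T - s) ^ p ≤
      η ^ m * (∫ s in R..T, s ^ γ * |y s| ^ m * (T - s) ^ (p + 1)) +
        (K / η) ^ (p + 1) * T ^ ((1 - β) * (p + 1)) * ∫ s in R..T, s ^ ((p + 1) * β - 1) := by
    rw [← intervalIntegral.integral_const_mul, ← intervalIntegral.integral_const_mul,
      ← intervalIntegral.integral_const_mul,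
      ← intervalIntegral.integral_add (i3.const_mul _) (i4.const_mul _)]
    refine intervalIntegral.integral_mono_on hRT (i2.const_mul _)
      ((i3.const_mul _).add (i4.const_mul _)) fun s hs => ?_
    exact young_weighted hm hmp hγ hK hη (hR1.trans hs.1) hs.2 (abs_nonneg _)
  have tail : ∫ s in R..T, s ^ ((p + 1) * β - 1) ≤ T ^ ((p + 1) * β) / ((p + 1) * β) := by
    rw [integral_rpow (Or.inl (by linarith)), sub_add_cancel]
    gcongr
    linarith [Real.rpow_nonneg hR.le ((p + 1) * β)]
  have e : T ^ ((1 - β) * (p + 1)) * T ^ ((p + 1) * β) = T ^ (p + 1) := by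
    rw [← Real.rpow_add hT]; congr 1; ring
  rw [← intervalIntegral.integral_add_adjacent_intervals i1 i2, mul_add, add_assoc]
  refine add_le_add ?_ (far.trans (add_le_add le_rfl ?_))
  · rw [Real.rpow_add hT, ← mul_assoc, mul_assoc (K * _)]
    gcongr
  · rw [← e, mul_div_assoc, mul_div_assoc, ← mul_assoc]
    gcongr

theorem integral_Ioi_nonpos_of_weighted_bound {g J : ℝ → ℝ} {m q β K D : ℝ} (hm : 0 < m)
    (hq : 0 < q) (hβ : 0 < β) (hK : 0 ≤ K)
    (hg : ∀ T, 0 ≤ T → IntervalIntegrable g volume 0 T) (hg0 : ∀ s, 0 ≤ s → 0 ≤ g s)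
    (hJ : ∀ R, 0 ≤ R → 0 ≤ J R)
    (H : ∀ η R T : ℝ, 0 < η → 1 ≤ R → R ≤ T →
      ∫ s in (0 : ℝ)..T, g s * (T - s) ^ q ≤ K * T ^ (q - β) * J R +
        η ^ m * (∫ s in R..T, g s * (T - s) ^ q) + (K / η) ^ q * T ^ q * D) :
    IntegrableOn g (Ioi 0) ∧ ∫ s in Ioi 0, g s ≤ 0 := by
  have hcont : ∀ T : ℝ, Continuous fun s : ℝ => (T - s) ^ q := fun T =>
    (Real.continuous_rpow_const hq.le).comp (continuous_const.sub continuous_id)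
  have hgi : ∀ a b : ℝ, 0 ≤ a → 0 ≤ b → IntervalIntegrable g volume a b := fun a b ha hb =>
    (hg a ha).symm.trans (hg b hb)
  have hwi : ∀ a b T : ℝ, 0 ≤ a → 0 ≤ b →
      IntervalIntegrable (fun s => g s * (T - s) ^ q) volume a b :=
    fun a b T ha hb => (hgi a b ha hb).mul_continuousOn (hcont T).continuousOn
  have hw0 : ∀ s T : ℝ, 0 ≤ s → s ≤ T → 0 ≤ g s * (T - s) ^ q := fun s T h0 hs =>
    mul_nonneg (hg0 s h0) (Real.rpow_nonneg (by linarith) _)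
  have hsplit : ∀ R T : ℝ, 0 ≤ R → 0 ≤ T → (∫ s in (0 : ℝ)..R, g s * (T - s) ^ q) +
      ∫ s in R..T, g s * (T - s) ^ q = ∫ s in (0 : ℝ)..T, g s * (T - s) ^ q := fun R T hR hT =>
    intervalIntegral.integral_add_adjacent_intervals (hwi _ _ _ le_rfl hR) (hwi _ _ _ hR hT)
  have hlow : ∀ t : ℝ, 0 < t →
      t ^ q * ∫ s in (0 : ℝ)..t, g s ≤ ∫ s in (0 : ℝ)..2 * t, g s * (2 * t - s) ^ q := by
    intro t ht
    rw [← hsplit t (2 * t) ht.le (by linarith), ← intervalIntegral.integral_const_mul]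
    refine le_add_of_le_of_nonneg ?_ (intervalIntegral.integral_nonneg (by linarith)
      fun s hs => hw0 s _ (ht.le.trans hs.1) hs.2)
    refine intervalIntegral.integral_mono_on ht.le ((hg t ht.le).const_mul _)
      (hwi _ _ _ le_rfl ht.le) fun s hs => ?_
    rw [mul_comm]
    exact mul_le_mul_of_nonneg_left
      (Real.rpow_le_rpow ht.le (by linarith [hs.2]) hq.le) (hg0 s hs.1)
  have hbdd : ∃ L : ℝ, ∀ t : ℝ, 1 ≤ t → ∫ s in (0 : ℝ)..t, g s ≤ L := by
    have hη : (0 : ℝ) < (1 / 2) ^ (1 / m) := by positivity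
    have hηm : ((1 / 2 : ℝ) ^ (1 / m)) ^ m = 1 / 2 := by
      rw [← Real.rpow_mul (by norm_num), one_div_mul_cancel hm.ne', Real.rpow_one]
    set η : ℝ := (1 / 2) ^ (1 / m)
    refine ⟨2 * 2 ^ q * (K * J 1 + (K / η) ^ q * D), fun t ht => ?_⟩
    have ht0 : 0 < t := by linarith
    have h1 := H η 1 (2 * t) hη le_rfl (by linarith)
    rw [hηm] at h1
    have h2 : 0 ≤ ∫ s in (0 : ℝ)..1, g s * (2 * t - s) ^ q :=
      intervalIntegral.integral_nonneg zero_le_one fun s hs => hw0 s _ hs.1 (by linarith [hs.2])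
    have h3 := hsplit 1 (2 * t) zero_le_one (by linarith)
    have h4 : (2 * t) ^ (q - β) ≤ (2 * t) ^ q :=
      Real.rpow_le_rpow_of_exponent_le (by linarith) (by linarith)
    have h5 : K * (2 * t) ^ (q - β) * J 1 ≤ K * (2 * t) ^ q * J 1 := by
      have := hJ 1 zero_le_one
      gcongr
    have h6 := hlow t ht0
    have h7 : (2 * t) ^ q = 2 ^ q * t ^ q := Real.mul_rpow (by norm_num) ht0.le
    have h8 : 0 < t ^ q := by positivity
    refine le_of_mul_le_mul_left ?_ h8
    calc _ ≤ _ := h6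
      _ ≤ 2 * (K * (2 * t) ^ q * J 1 + (K / η) ^ q * (2 * t) ^ q * D) := by linarith
      _ = _ := by rw [h7]; ring
  obtain ⟨L, hL⟩ := hbdd
  have hint : IntegrableOn g (Ioi 0) := by
    refine integrableOn_Ioi_of_intervalIntegral_norm_bounded L 0 (b := id) (l := atTop)
      (fun t => ?_) tendsto_id ?_
    · rcases le_total 0 t with ht | ht
      · exact (hg t ht).1
      · simp [Ioc_eq_empty_of_le ht]
    · filter_upwards [eventually_ge_atTop 1] with t ht
      refine le_of_eq_of_le (intervalIntegral.integral_congr fun s hs => ?_) (hL t ht)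
      rw [id, uIcc_of_le (by linarith)] at hs
      exact Real.norm_of_nonneg (hg0 s hs.1)
  refine ⟨hint, ?_⟩
  set I : ℝ := ∫ s in Ioi 0, g s
  have hlim : Tendsto (fun t => ∫ s in (0 : ℝ)..t, g s) atTop (𝓝 I) :=
    intervalIntegral_tendsto_integral_Ioi 0 hint tendsto_id
  have hleI : ∀ t : ℝ, 0 ≤ t → ∫ s in (0 : ℝ)..t, g s ≤ I := by
    intro t ht
    rw [intervalIntegral.integral_of_le ht]
    refine setIntegral_mono_set hint ?_ Ioc_subset_Ioi_self.eventuallyLE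
    exact (ae_restrict_iff' measurableSet_Ioi).2 (ae_of_all _ fun s hs => hg0 s (le_of_lt hs))
  have hup : ∀ R T : ℝ, 0 ≤ R → R ≤ T →
      ∫ s in R..T, g s * (T - s) ^ q ≤ T ^ q * (I - ∫ s in (0 : ℝ)..R, g s) := by
    intro R T hR hRT
    have hT : 0 ≤ T := hR.trans hRT
    have h1 : ∫ s in R..T, g s * (T - s) ^ q ≤ ∫ s in R..T, T ^ q * g s := by
      refine intervalIntegral.integral_mono_on hRT (hwi _ _ _ hR hT)
        ((hgi _ _ hR hT).const_mul _) fun s hs => ?_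
      rw [mul_comm]
      exact mul_le_mul_of_nonneg_right (Real.rpow_le_rpow (by linarith [hs.2])
        (by linarith [hs.1]) hq.le) (hg0 s (hR.trans hs.1))
    rw [intervalIntegral.integral_const_mul] at h1
    refine h1.trans (mul_le_mul_of_nonneg_left ?_ (by positivity))
    linarith [hleI T hT,
      intervalIntegral.integral_add_adjacent_intervals (hgi 0 R le_rfl hR) (hgi R T hR hT)]
  have hfin : ∀ η R : ℝ, 0 < η → 1 ≤ R →
      I ≤ 2 ^ q * (η ^ m * (I - ∫ s in (0 : ℝ)..R, g s) + (K / η) ^ q * D) := by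
    intro η R hη hR
    have hright : Tendsto (fun t : ℝ => K * 2 ^ (q - β) * J R * t ^ (-β) +
        2 ^ q * (η ^ m * (I - ∫ s in (0 : ℝ)..R, g s) + (K / η) ^ q * D)) atTop
        (𝓝 (2 ^ q * (η ^ m * (I - ∫ s in (0 : ℝ)..R, g s) + (K / η) ^ q * D))) := by
      simpa using ((tendsto_rpow_neg_atTop hβ).const_mul (K * 2 ^ (q - β) * J R)).add_const
        (2 ^ q * (η ^ m * (I - ∫ s in (0 : ℝ)..R, g s) + (K / η) ^ q * D))
    refine le_of_tendsto_of_tendsto hlim hright ?_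
    filter_upwards [eventually_ge_atTop R] with t ht
    have ht0 : 0 < t := by linarith
    have h1 := H η R (2 * t) hη hR (by linarith)
    have h2 := mul_le_mul_of_nonneg_left (hup R (2 * t) (by linarith) (by linarith))
      (by positivity : 0 ≤ η ^ m)
    have h7 : (2 * t) ^ q = 2 ^ q * t ^ q := Real.mul_rpow (by norm_num) ht0.le
    have h8 : (2 * t) ^ (q - β) = 2 ^ (q - β) * (t ^ q * t ^ (-β)) := by
      rw [Real.mul_rpow (by norm_num) ht0.le, ← Real.rpow_add ht0, sub_eq_add_neg]
    refine le_of_mul_le_mul_left ?_ (by positivity : 0 < t ^ q)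
    calc _ ≤ _ := hlow t ht0
      _ ≤ _ := h1
      _ ≤ K * (2 * t) ^ (q - β) * J R + η ^ m * ((2 * t) ^ q * (I - ∫ s in (0 : ℝ)..R, g s)) +
          (K / η) ^ q * (2 * t) ^ q * D := by linarith
      _ = _ := by rw [h7, h8]; ring
  have hfin' : ∀ η : ℝ, 0 < η → I ≤ 2 ^ q * ((K / η) ^ q * D) := by
    intro η hη
    have hright : Tendsto (fun R : ℝ =>
        2 ^ q * (η ^ m * (I - ∫ s in (0 : ℝ)..R, g s) + (K / η) ^ q * D)) atTop
        (𝓝 (2 ^ q * (η ^ m * (I - I) + (K / η) ^ q * D))) :=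
      (((hlim.const_sub I).const_mul _).add_const _).const_mul _
    rw [sub_self, mul_zero, zero_add] at hright
    refine ge_of_tendsto hright ?_
    filter_upwards [eventually_ge_atTop 1] with R hR using hfin η R hη hR
  have hzero : Tendsto (fun η : ℝ => 2 ^ q * ((K / η) ^ q * D)) atTop (𝓝 0) := by
    have h1 : Tendsto (fun η : ℝ => (K / η) ^ q) atTop (𝓝 0) := by
      have := (tendsto_const_nhds (x := K)).div_atTop (tendsto_id (α := ℝ))
      simpa [Real.zero_rpow hq.ne'] using this.rpow_const (Or.inr hq.le)
    simpa using (h1.mul_const D).const_mul (2 ^ q)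
  refine ge_of_tendsto hzero ?_
  filter_upwards [eventually_gt_atTop 0] with η hη using hfin' η hη

theorem stmt_9 (β γ m b : ℝ)
    (hβ0 : 0 < β) (hβ1 : β < 1) (hγ : -β < γ)
    (hm1 : 1 < m) (hm2 : m ≤ (γ + 1) / (1 - β)) (hb : 0 ≤ b)
    (y : ℝ → ℝ)
    (hycont : ContinuousOn y (Set.Ici 0))
    (hy0 : y 0 = b)
    (hydiff : ∀ t > (0 : ℝ), DifferentiableAt ℝ y t)
    (hDdiff : ∀ t > (0 : ℝ), DifferentiableAt ℝ (RLI (1 - β) y) t)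
    (hineq : ∀ t > (0 : ℝ), t ^ γ * |y t| ^ m ≤ deriv y t + RLD β y t) :
    ∀ t ≥ (0 : ℝ), y t = 0 := by
  set p : ℝ := 1 / (m - 1) with hp
  have hm0 : 0 < m - 1 := by linarith
  have hp0 : 0 < p := by positivity
  have hmp : m * p = p + 1 := by rw [hp]; field_simp; ring
  have hσ : 0 < 1 - β := by linarith
  have hcrit : m * (1 - β) ≤ γ + 1 := (le_div_iff₀ hσ).1 hm2
  have hΓ : 0 < Real.Gamma (1 - β) := Real.Gamma_pos_of_pos hσ
  set g : ℝ → ℝ := fun s => s ^ γ * |y s| ^ m with hg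
  set K : ℝ := (p + 1) * (1 + 1 / ((1 - β) * Real.Gamma (1 - β))) with hK
  have hK0 : 0 ≤ K := by positivity
  have hg0 : ∀ s, 0 ≤ s → 0 ≤ g s := fun s hs => by positivity
  have hgpos : ∀ T, 0 ≤ T → IntervalIntegrable g volume 0 T := fun T hT =>
    (intervalIntegral.intervalIntegrable_rpow' (by linarith)).mul_continuousOn
      ((uIcc_of_le hT ▸ hycont.mono Icc_subset_Ici_self).abs.rpow_const
        fun _ _ => Or.inr (by linarith))
  obtain ⟨hint, hle⟩ := integral_Ioi_nonpos_of_weighted_bound (g := g)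
    (J := fun R => ∫ s in (0 : ℝ)..R, |y s|) (m := m) (q := p + 1) (β := β) (K := K)
    (D := 1 / ((p + 1) * β)) (by linarith) (by linarith) hβ0 hK0 hgpos hg0
    (fun R hR => intervalIntegral.integral_nonneg hR fun _ _ => abs_nonneg _) (by
      intro η R T hη hR hRT
      refine (integral_mul_rpow_le_of_le_deriv_add_RLD hβ1 hp0.le (hR.trans hRT) hycont
        (hy0 ▸ hb) hydiff hDdiff (hgpos T (by linarith)) hineq).trans ?_
      refine (integral_abs_mul_rpow_le hm1 hmp hβ0 hcrit hK0 hη hR hRT hycont).trans_eq ?_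
      rw [show 1 - β + p = p + 1 - β by ring, mul_one_div])
  have hg0' : 0 ≤ᵐ[volume.restrict (Ioi 0)] g :=
    (ae_restrict_iff' measurableSet_Ioi).2 (ae_of_all _ fun s hs => hg0 s (le_of_lt hs))
  have hae : g =ᵐ[volume.restrict (Ioi 0)] 0 :=
    (setIntegral_eq_zero_iff_of_nonneg_ae hg0' hint).1
      (le_antisymm hle (integral_nonneg_of_ae hg0'))
  have hyae : y =ᵐ[volume.restrict (Ioi 0)] 0 := by
    filter_upwards [hae, ae_restrict_mem measurableSet_Ioi] with s hs hs0
    have h1 : s ^ γ ≠ 0 := (Real.rpow_pos_of_pos hs0 γ).ne'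
    have h2 : |y s| ^ m = 0 := (mul_eq_zero.1 hs).resolve_left h1
    exact abs_eq_zero.1 ((Real.rpow_eq_zero (abs_nonneg _) (by linarith)).1 h2)
  have hyIoi : EqOn y 0 (Ioi 0) := Measure.eqOn_open_of_ae_eq hyae isOpen_Ioi
    (hycont.mono Ioi_subset_Ici_self) continuousOn_const
  have hyIci : EqOn y 0 (Ici 0) := hyIoi.of_subset_closure hycont continuousOn_const
    Ioi_subset_Ici_self (by rw [closure_Ioi])
  exact fun t ht => hyIci ht
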